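/- Let f and g be [α,θ₁,θ₂]-defined and [β,θ₁,θ₂]-defined functions of the same type — either both single-defined or both double-defined — with |α| > |β|. Then |f(x)| ≥ |g(x)| for all x ∈ [0,1]. -/

import Mathlib

open Set

/-- The function `Elastic α d₁ d₂` on `[0,1]`. -/
noncomputable def Elastic (α d₁ d₂ : ℝ) : ℝ → ℝ := fun x =>
  if x ≤ 1/2 then α * (1 - (2*x - 1)^2 * Real.exp (-2*d₁*x))
  else α * (1 - (2*x - 1)^2 * Real.exp (-2*d₂*(1-x)))

/-- `C : [0,1] → ℝ` is single-`[α,θ₁,θ₂]`-defined: it belongs to the `[α]`-elastic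
family and its one-sided derivatives at the endpoints are `θ₁` and `θ₂`. -/
def IsSingleDefined (α θ₁ θ₂ : ℝ) (C : ℝ → ℝ) : Prop :=
  (∃ d₁ d₂ : ℝ, 0 ≤ d₁ ∧ 0 ≤ d₂ ∧ ∀ x ∈ Icc (0:ℝ) 1, C x = Elastic α d₁ d₂ x) ∧
  derivWithin C (Icc 0 1) 0 = θ₁ ∧ derivWithin C (Icc 0 1) 1 = θ₂

/-- `C : [0,1] → ℝ` is double-`[α,θ₁,θ₂]`-defined, with middle slope `θ = -4α`. -/
def IsDoubleDefined (α θ₁ θ₂ : ℝ) (C : ℝ → ℝ) : Prop :=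
  ∃ C₁ C₂ : ℝ → ℝ,
    IsSingleDefined (α/2) (θ₁/2) ((-4*α)/2) C₁ ∧
    IsSingleDefined (-α/2) ((-4*α)/2) (θ₂/2) C₂ ∧
    ∀ x ∈ Icc (0:ℝ) 1, C x = if x ≤ 1/2 then C₁ (2*x) else C₂ (2*x - 1)

theorem elastic_branch_abs_le {α β d e y : ℝ} (hβ : |β| ≤ |α|) (hd : 0 ≤ d) (he : 0 ≤ e)
    (hy₀ : 0 ≤ y) (hy₁ : y ≤ 1/2)
    (h : α * (4 + 2*d) = β * (4 + 2*e) ∨ (d = 0 ∧ e = 0)) :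
    |β * (1 - (2*y - 1)^2 * Real.exp (-2*e*y))| ≤
      |α * (1 - (2*y - 1)^2 * Real.exp (-2*d*y))| := by
  have hs : (2*y - 1)^2 ≤ 1 := by nlinarith
  have factor_nonneg : ∀ c : ℝ, 0 ≤ c → 0 ≤ 1 - (2*y - 1)^2 * Real.exp (-2*c*y) := by
    intro c hc
    have h1 : Real.exp (-2*c*y) ≤ 1 := Real.exp_le_one_iff.mpr (by nlinarith [mul_nonneg hc hy₀])
    nlinarith [mul_le_one₀ hs (Real.exp_pos (-2*c*y)).le h1]
  rw [abs_mul, abs_mul, abs_of_nonneg (factor_nonneg d hd), abs_of_nonneg (factor_nonneg e he)]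
  rcases h with h | ⟨rfl, rfl⟩
  · have habs : |α| * (4 + 2*d) = |β| * (4 + 2*e) := by
      have := congrArg abs h
      rwa [abs_mul, abs_mul, abs_of_nonneg (by linarith : 0 ≤ 4 + 2*d),
        abs_of_nonneg (by linarith : 0 ≤ 4 + 2*e)] at this
    have hb := abs_nonneg β
    generalize |α| = a at *
    generalize |β| = b at *
    have hE := Real.exp_pos (-2*d*y)
    have htangent : Real.exp (-2*d*y) * (1 - 2*(e - d)*y) ≤ Real.exp (-2*e*y) := by
      have hsplit : Real.exp (-2*e*y) = Real.exp (-2*d*y) * Real.exp (-2*(e - d)*y) := by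
        rw [← Real.exp_add]; congr 1; ring
      rw [hsplit]
      exact mul_le_mul_of_nonneg_left
        (by linarith [Real.add_one_le_exp (-2*(e - d)*y)]) hE.le
    have hinv : Real.exp (-2*d*y) * (1 + 2*d*y) ≤ 1 := by
      have h1 : 1 + 2*d*y ≤ Real.exp (2*d*y) := by linarith [Real.add_one_le_exp (2*d*y)]
      calc Real.exp (-2*d*y) * (1 + 2*d*y) ≤ Real.exp (-2*d*y) * Real.exp (2*d*y) :=
            mul_le_mul_of_nonneg_left h1 hE.le
        _ = 1 := by rw [← Real.exp_add]; simp
    have hpoly : (2*y - 1)^2 * (1 + 2*(2 + d)*y) ≤ 1 + 2*d*y := by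
      have h1 : 0 ≤ y^2 * (3 - 4*y) := mul_nonneg (sq_nonneg y) (by linarith)
      have h2 : 0 ≤ d*y * (1 - (2*y - 1)^2) :=
        mul_nonneg (mul_nonneg hd hy₀) (by linarith)
      nlinarith
    have hslope : (2*y - 1)^2 * Real.exp (-2*d*y) * (1 + 2*(2 + d)*y) ≤ 1 := by
      have := mul_le_mul_of_nonneg_left hpoly hE.le
      linarith
    have h1 := mul_le_mul_of_nonneg_left htangent (mul_nonneg hb (sq_nonneg (2*y - 1)))
    have h2 := mul_le_mul_of_nonneg_left hslope (sub_nonneg.mpr hβ)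
    have hbe : b * (e - d) = (a - b) * (2 + d) := by linarith
    have h3 : b * (2*y - 1)^2 * (Real.exp (-2*d*y) * (1 - 2*(e - d)*y)) =
        (2*y - 1)^2 * Real.exp (-2*d*y) * (b - 2*((a - b) * (2 + d))*y) := by
      rw [← hbe]; ring
    rw [h3] at h1
    linarith
  · exact mul_le_mul_of_nonneg_right hβ (factor_nonneg 0 le_rfl)

theorem Elastic_abs_le {α β d₁ d₂ e₁ e₂ x : ℝ} (hβ : |β| ≤ |α|)
    (hd₁ : 0 ≤ d₁) (hd₂ : 0 ≤ d₂) (he₁ : 0 ≤ e₁) (he₂ : 0 ≤ e₂) (hx : x ∈ Icc (0:ℝ) 1)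
    (h₁ : α * (4 + 2*d₁) = β * (4 + 2*e₁) ∨ (d₁ = 0 ∧ e₁ = 0))
    (h₂ : α * (4 + 2*d₂) = β * (4 + 2*e₂) ∨ (d₂ = 0 ∧ e₂ = 0)) :
    |Elastic β e₁ e₂ x| ≤ |Elastic α d₁ d₂ x| := by
  unfold Elastic
  split_ifs with hx'
  · exact elastic_branch_abs_le hβ hd₁ he₁ hx.1 hx' h₁
  · have := elastic_branch_abs_le (y := 1 - x) hβ hd₂ he₂ (by linarith [hx.2])
      (by linarith) h₂
    rwa [show (2*(1 - x) - 1)^2 = (2*x - 1)^2 by ring] at this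

theorem hasDerivAt_elastic_branch_zero (α d : ℝ) :
    HasDerivAt (fun x : ℝ => α * (1 - (2*x - 1)^2 * Real.exp (-2*d*x))) (α * (4 + 2*d)) 0 := by
  have h1 : HasDerivAt (fun x : ℝ => 2*x - 1) 2 0 := by
    simpa using ((hasDerivAt_id (0:ℝ)).const_mul 2).sub_const 1
  have h2 : HasDerivAt (fun x : ℝ => -2*d*x) (-2*d) 0 := by
    simpa using (hasDerivAt_id (0:ℝ)).const_mul (-2*d)
  refine ((((h1.pow 2).mul h2.exp).const_sub 1).const_mul α).congr_deriv ?_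
  simp [-mul_eq_mul_left_iff]
  ring

theorem hasDerivAt_elastic_branch_one (α d : ℝ) :
    HasDerivAt (fun x : ℝ => α * (1 - (2*x - 1)^2 * Real.exp (-2*d*(1-x))))
      (-(α * (4 + 2*d))) 1 := by
  have h1 : HasDerivAt (fun x : ℝ => 1 - x) (-1) 1 := by
    simpa using (hasDerivAt_id (1:ℝ)).const_sub 1
  have h0 := hasDerivAt_elastic_branch_zero α d
  rw [show (0:ℝ) = 1 - 1 by norm_num] at h0
  have hcomp := (h0.comp 1 h1).congr_deriv (mul_neg_one (α * (4 + 2*d)))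
  refine hcomp.congr_of_eventuallyEq (Filter.Eventually.of_forall fun x => ?_)
  simp only [Function.comp_apply]
  ring

theorem IsSingleDefined.exists_elastic {α θ₁ θ₂ : ℝ} {C : ℝ → ℝ}
    (h : IsSingleDefined α θ₁ θ₂ C) :
    ∃ d₁ d₂ : ℝ, 0 ≤ d₁ ∧ 0 ≤ d₂ ∧ (∀ x ∈ Icc (0:ℝ) 1, C x = Elastic α d₁ d₂ x) ∧
      θ₁ = α * (4 + 2*d₁) ∧ θ₂ = -(α * (4 + 2*d₂)) := by
  obtain ⟨⟨d₁, d₂, hd₁, hd₂, hC⟩, rfl, rfl⟩ := h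
  have hu := uniqueDiffOn_Icc (zero_lt_one (α := ℝ))
  refine ⟨d₁, d₂, hd₁, hd₂, hC, ?_, ?_⟩
  · refine HasDerivWithinAt.derivWithin ?_ (hu 0 (by simp))
    refine (hasDerivAt_elastic_branch_zero α d₁).hasDerivWithinAt.congr_of_eventuallyEq_of_mem
      ?_ (by simp)
    filter_upwards [self_mem_nhdsWithin,
      mem_nhdsWithin_of_mem_nhds (Iio_mem_nhds (by norm_num : (0:ℝ) < 1/2))] with x hx hx'
    rw [hC x hx, Elastic, if_pos (le_of_lt hx')]
  · refine HasDerivWithinAt.derivWithin ?_ (hu 1 (by simp))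
    refine (hasDerivAt_elastic_branch_one α d₂).hasDerivWithinAt.congr_of_eventuallyEq_of_mem
      ?_ (by simp)
    filter_upwards [self_mem_nhdsWithin,
      mem_nhdsWithin_of_mem_nhds (Ioi_mem_nhds (by norm_num : (1/2:ℝ) < 1))] with x hx hx'
    rw [hC x hx, Elastic, if_neg (not_le.mpr hx')]

theorem defined_abs_mono (α β θ₁ θ₂ : ℝ) (f g : ℝ → ℝ) (hβ : |β| < |α|)
    (h : (IsSingleDefined α θ₁ θ₂ f ∧ IsSingleDefined β θ₁ θ₂ g) ∨
         (IsDoubleDefined α θ₁ θ₂ f ∧ IsDoubleDefined β θ₁ θ₂ g)) :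
    ∀ x ∈ Icc (0:ℝ) 1, |g x| ≤ |f x| := by
  have hα : α ≠ 0 := abs_pos.mp ((abs_nonneg β).trans_lt hβ)
  rintro x hx
  rcases h with ⟨hf, hg⟩ | ⟨⟨F₁, F₂, hF₁, hF₂, hf⟩, ⟨G₁, G₂, hG₁, hG₂, hg⟩⟩
  · obtain ⟨d₁, d₂, hd₁, hd₂, hf, hfθ₁, hfθ₂⟩ := hf.exists_elastic
    obtain ⟨e₁, e₂, he₁, he₂, hg, hgθ₁, hgθ₂⟩ := hg.exists_elastic
    rw [hf x hx, hg x hx]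
    exact Elastic_abs_le hβ.le hd₁ hd₂ he₁ he₂ hx (Or.inl (by linarith)) (Or.inl (by linarith))
  · obtain ⟨d₁, d₂, hd₁, hd₂, hF₁, hFθ₁, hFm₁⟩ := hF₁.exists_elastic
    obtain ⟨d₃, d₄, hd₃, hd₄, hF₂, hFm₂, hFθ₂⟩ := hF₂.exists_elastic
    obtain ⟨e₁, e₂, he₁, he₂, hG₁, hGθ₁, hGm₁⟩ := hG₁.exists_elastic
    obtain ⟨e₃, e₄, he₃, he₄, hG₂, hGm₂, hGθ₂⟩ := hG₂.exists_elastic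
    have hβ₀ : β ≠ 0 := by
      rintro rfl
      have : α * (4 + 2*d₁) = 0 := by linarith
      exact mul_ne_zero hα (by linarith) this
    have hd₂₀ : d₂ = 0 := (mul_eq_zero_iff_left hα).mp (by linarith)
    have hd₃₀ : d₃ = 0 := (mul_eq_zero_iff_left hα).mp (by linarith)
    have he₂₀ : e₂ = 0 := (mul_eq_zero_iff_left hβ₀).mp (by linarith)
    have he₃₀ : e₃ = 0 := (mul_eq_zero_iff_left hβ₀).mp (by linarith)
    rw [hf x hx, hg x hx]
    split_ifs with hx'
    · have hx₁ : 2*x ∈ Icc (0:ℝ) 1 := ⟨by linarith [hx.1], by linarith⟩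
      rw [hF₁ _ hx₁, hG₁ _ hx₁]
      refine Elastic_abs_le ?_ hd₁ hd₂ he₁ he₂ hx₁ (Or.inl (by linarith)) (Or.inr ⟨hd₂₀, he₂₀⟩)
      rw [abs_div, abs_div]
      gcongr
    · have hx₂ : 2*x - 1 ∈ Icc (0:ℝ) 1 := ⟨by linarith, by linarith [hx.2]⟩
      rw [hF₂ _ hx₂, hG₂ _ hx₂]
      refine Elastic_abs_le ?_ hd₃ hd₄ he₃ he₄ hx₂ (Or.inr ⟨hd₃₀, he₃₀⟩) (Or.inl (by linarith))
      rw [abs_div, abs_div, abs_neg, abs_neg]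
      gcongr
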